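/- Let n be a natural number, let G be a symmetric, negative definite n×n integer matrix, and let α₀ ∈ ℤⁿ be a characteristic vector for G. Then the maximum of αᵀG⁻¹α over the coset α₀ + 2Gℤⁿ equals the maximum of αᵀG⁻¹α over the finite set of vectors α ∈ α₀ + 2Gℤⁿ satisfying Gᵢᵢ ≤ αᵢ ≤ −Gᵢᵢ for every index i; moreover this finite set is nonempty. -/

import Mathlib

open Matrix

/-- `α` is a characteristic vector for `G`: for every `v ∈ ℤⁿ`,
`α ⬝ᵥ v ≡ vᵀGv (mod 2)`. -/
def IsCharVec (n : ℕ) (G : Matrix (Fin n) (Fin n) ℤ) (α : Fin n → ℤ) : Prop :=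
  ∀ v : Fin n → ℤ, α ⬝ᵥ v ≡ v ⬝ᵥ (G *ᵥ v) [ZMOD 2]

/-- The rational number `αᵀ G⁻¹ α`, computed with the inverse of `G` over `ℚ`. -/
noncomputable def quadQ (n : ℕ) (G : Matrix (Fin n) (Fin n) ℤ) (α : Fin n → ℤ) : ℚ :=
  (fun i => (α i : ℚ)) ⬝ᵥ ((G.map ((↑) : ℤ → ℚ))⁻¹ *ᵥ fun i => (α i : ℚ))

/-- The linear-plus-quadratic integer form `x ↦ α ⬝ᵥ x + xᵀGx` which governs the variation of
`quadQ` along the coset `α + 2Gℤⁿ`. -/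
def cosetForm {n : ℕ} (G : Matrix (Fin n) (Fin n) ℤ) (α x : Fin n → ℤ) : ℤ :=
  α ⬝ᵥ x + x ⬝ᵥ (G *ᵥ x)

theorem isUnit_det_of_forall_dotProduct_mulVec_neg {n : ℕ} {A : Matrix (Fin n) (Fin n) ℚ}
    (hA : ∀ v : Fin n → ℚ, v ≠ 0 → v ⬝ᵥ (A *ᵥ v) < 0) : IsUnit A.det := by
  rw [isUnit_iff_ne_zero]
  intro h
  obtain ⟨v, hv, hAv⟩ := Matrix.exists_mulVec_eq_zero_iff.mpr h
  simpa [hAv] using hA v hv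

theorem dotProduct_inv_mulVec_nonpos {n : ℕ} {A : Matrix (Fin n) (Fin n) ℚ}
    (hA : ∀ v : Fin n → ℚ, v ≠ 0 → v ⬝ᵥ (A *ᵥ v) < 0) (a : Fin n → ℚ) :
    a ⬝ᵥ (A⁻¹ *ᵥ a) ≤ 0 := by
  have hdet := isUnit_det_of_forall_dotProduct_mulVec_neg hA
  have h : A *ᵥ (A⁻¹ *ᵥ a) = a := by
    rw [mulVec_mulVec, mul_nonsing_inv _ hdet, one_mulVec]
  by_cases hw : A⁻¹ *ᵥ a = 0
  · simp [hw]
  · have := hA _ hw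
    rw [h, dotProduct_comm] at this
    exact this.le

theorem dotProduct_mulVec_comm_of_isSymm {n : ℕ} {R : Type*} [CommRing R]
    {A : Matrix (Fin n) (Fin n) R} (hA : A.IsSymm) (v w : Fin n → R) :
    v ⬝ᵥ (A *ᵥ w) = w ⬝ᵥ (A *ᵥ v) := by
  rw [dotProduct_mulVec, ← mulVec_transpose, hA.eq, dotProduct_comm]

theorem dotProduct_inv_mulVec_add_two_mulVec {n : ℕ} {A : Matrix (Fin n) (Fin n) ℚ}
    (hsymm : A.IsSymm) (hdet : IsUnit A.det) (a x : Fin n → ℚ) :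
    (a + (2 : ℚ) • (A *ᵥ x)) ⬝ᵥ (A⁻¹ *ᵥ (a + (2 : ℚ) • (A *ᵥ x))) =
      a ⬝ᵥ (A⁻¹ *ᵥ a) + 4 * (a ⬝ᵥ x + x ⬝ᵥ (A *ᵥ x)) := by
  have hx : A⁻¹ *ᵥ (A *ᵥ x) = x := by
    rw [mulVec_mulVec, nonsing_inv_mul _ hdet, one_mulVec]
  have ha : A *ᵥ (A⁻¹ *ᵥ a) = a := by
    rw [mulVec_mulVec, mul_nonsing_inv _ hdet, one_mulVec]
  have hcross : (A *ᵥ x) ⬝ᵥ (A⁻¹ *ᵥ a) = a ⬝ᵥ x := by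
    rw [dotProduct_comm, dotProduct_mulVec_comm_of_isSymm hsymm, ha, dotProduct_comm]
  rw [mulVec_add, mulVec_smul, hx]
  simp only [add_dotProduct, dotProduct_add, smul_dotProduct, dotProduct_smul, smul_eq_mul, hcross,
    dotProduct_comm (A *ᵥ x) x]
  ring

theorem quadQ_add_two_smul_mulVec {n : ℕ} {G : Matrix (Fin n) (Fin n) ℤ} (hG : G.IsSymm)
    (hdet : IsUnit (G.map ((↑) : ℤ → ℚ)).det) (α x : Fin n → ℤ) :
    quadQ n G (α + 2 • (G *ᵥ x)) = quadQ n G α + 4 * (cosetForm G α x : ℚ) := by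
  have h := dotProduct_inv_mulVec_add_two_mulVec (hG.map ((↑) : ℤ → ℚ)) hdet
    (fun i => (α i : ℚ)) (fun i => (x i : ℚ))
  have hcast : (fun i => ((α + 2 • (G *ᵥ x)) i : ℚ)) =
      (fun i => (α i : ℚ)) + (2 : ℚ) • (G.map ((↑) : ℤ → ℚ) *ᵥ fun i => (x i : ℚ)) := by
    ext i
    simp [mulVec, dotProduct]
  have hform : (cosetForm G α x : ℚ) = (fun i => (α i : ℚ)) ⬝ᵥ (fun i => (x i : ℚ)) +
      (fun i => (x i : ℚ)) ⬝ᵥ (G.map ((↑) : ℤ → ℚ) *ᵥ fun i => (x i : ℚ)) := by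
    simp [cosetForm, mulVec, dotProduct]
  rw [quadQ, hcast, h, hform, quadQ]

theorem cosetForm_add {n : ℕ} {G : Matrix (Fin n) (Fin n) ℤ} (hG : G.IsSymm)
    (α x y : Fin n → ℤ) :
    cosetForm G α (x + y) =
      cosetForm G α x + (α + 2 • (G *ᵥ x)) ⬝ᵥ y + y ⬝ᵥ (G *ᵥ y) := by
  simp only [cosetForm, mulVec_add, dotProduct_add, add_dotProduct, two_smul,
    dotProduct_mulVec_comm_of_isSymm hG x y, dotProduct_comm (G *ᵥ x) y]
  ring

/-- A maximizer of `cosetForm` cannot be improved by a step along a coordinate axis, which bounds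
the coordinates of the corresponding coset element. -/
theorem mem_box_of_forall_cosetForm_le {n : ℕ} {G : Matrix (Fin n) (Fin n) ℤ} (hG : G.IsSymm)
    {α x : Fin n → ℤ} (hx : ∀ y, cosetForm G α y ≤ cosetForm G α x) (i : Fin n) :
    G i i ≤ (α + 2 • (G *ᵥ x)) i ∧ (α + 2 • (G *ᵥ x)) i ≤ -(G i i) := by
  have hpos := hx (x + Pi.single i 1)
  have hneg := hx (x + -Pi.single i 1)
  rw [cosetForm_add hG] at hpos hneg
  simp only [mulVec_neg, dotProduct_neg, neg_dotProduct, neg_neg, mulVec_single_one,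
    dotProduct_single_one, single_one_dotProduct, col_apply] at hpos hneg
  constructor <;> linarith

theorem exists_forall_cosetForm_le {n : ℕ} {G : Matrix (Fin n) (Fin n) ℤ} (hG : G.IsSymm)
    (hneg : ∀ v : Fin n → ℚ, v ≠ 0 → v ⬝ᵥ ((G.map ((↑) : ℤ → ℚ)) *ᵥ v) < 0)
    (α : Fin n → ℤ) : ∃ x, ∀ y, cosetForm G α y ≤ cosetForm G α x := by
  have hdet := isUnit_det_of_forall_dotProduct_mulVec_neg hneg
  have hbdd : ∀ z, (∃ x, cosetForm G α x = z) → z ≤ ⌊-quadQ n G α / 4⌋ := by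
    rintro _ ⟨x, rfl⟩
    have hle : quadQ n G (α + 2 • (G *ᵥ x)) ≤ 0 :=
      dotProduct_inv_mulVec_nonpos hneg _
    rw [quadQ_add_two_smul_mulVec hG hdet] at hle
    rw [Int.le_floor]
    linarith
  obtain ⟨_, ⟨x, rfl⟩, hmax⟩ := Int.exists_greatest_of_bdd ⟨_, hbdd⟩ ⟨_, 0, rfl⟩
  exact ⟨x, fun y => hmax _ ⟨y, rfl⟩⟩

/-- For symmetric negative definite `G` and a characteristic vector `α₀`, the subset of
the coset `α₀ + 2Gℤⁿ` cut out by `Gᵢᵢ ≤ αᵢ ≤ -Gᵢᵢ` is finite and nonempty, and it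
contains an element realizing the maximum of `αᵀG⁻¹α` over the whole coset. -/
theorem quad_max_on_finite_box (n : ℕ) (G : Matrix (Fin n) (Fin n) ℤ) (hG : G.IsSymm)
    (hneg : ∀ v : Fin n → ℚ, v ≠ 0 → v ⬝ᵥ ((G.map ((↑) : ℤ → ℚ)) *ᵥ v) < 0)
    (α₀ : Fin n → ℤ) (hα₀ : IsCharVec n G α₀) :
    Set.Finite {α : Fin n → ℤ | (∃ x : Fin n → ℤ, α = α₀ + 2 • (G *ᵥ x)) ∧
        ∀ i : Fin n, G i i ≤ α i ∧ α i ≤ -(G i i)} ∧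
      Set.Nonempty {α : Fin n → ℤ | (∃ x : Fin n → ℤ, α = α₀ + 2 • (G *ᵥ x)) ∧
        ∀ i : Fin n, G i i ≤ α i ∧ α i ≤ -(G i i)} ∧
      ∃ α : Fin n → ℤ, ((∃ x : Fin n → ℤ, α = α₀ + 2 • (G *ᵥ x)) ∧
          ∀ i : Fin n, G i i ≤ α i ∧ α i ≤ -(G i i)) ∧
        ∀ β : Fin n → ℤ, (∃ x : Fin n → ℤ, β = α₀ + 2 • (G *ᵥ x)) →
          quadQ n G β ≤ quadQ n G α := by
  obtain ⟨x, hx⟩ := exists_forall_cosetForm_le hG hneg α₀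
  have hbox := mem_box_of_forall_cosetForm_le hG hx
  refine ⟨?_, ⟨_, ⟨x, rfl⟩, hbox⟩, _, ⟨⟨x, rfl⟩, hbox⟩, ?_⟩
  · exact (Set.finite_Icc (fun i => G i i) (fun i => -(G i i))).subset
      fun α hα => ⟨fun i => (hα.2 i).1, fun i => (hα.2 i).2⟩
  · rintro _ ⟨y, rfl⟩
    have hdet := isUnit_det_of_forall_dotProduct_mulVec_neg hneg
    rw [quadQ_add_two_smul_mulVec hG hdet, quadQ_add_two_smul_mulVec hG hdet]
    have hle : (cosetForm G α₀ y : ℚ) ≤ cosetForm G α₀ x := by exact_mod_cast hx y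
    linarith
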